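/- arXiv:2208.03981 — 2 statements merged into one kernel-verified Lean document; each statement's English description precedes it below -/
import Mathlib

section
/- Let A₀ be a densely defined skew-symmetric operator on a Hilbert space V over 𝕂 = ℝ or ℂ, let Ā₀ denote its closure, and let A = (−A₀)*. Then D(A) decomposes as the algebraic direct sum D(A) = D(Ā₀) ⊕ ker(Id − A) ⊕ ker(Id + A): every w ∈ D(A) can be written uniquely as w = w₀ + w₊ + w₋ with w₀ ∈ D(Ā₀), Aw₊ = w₊ and Aw₋ = −w₋. -/
variable {𝕜 V : Type*} [RCLike 𝕜] [NormedAddCommGroup V] [InnerProductSpace 𝕜 V]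
  [CompleteSpace V]

/-- An operator `A` on `V` is *skew-symmetric* if `⟪Au, v⟫ + ⟪u, Av⟫ = 0` for all
`u, v ∈ D(A)`. -/
def SkewSymmetric (A : V →ₗ.[𝕜] V) : Prop :=
  ∀ u v : A.domain, @inner 𝕜 _ _ (A u) (v : V) + @inner 𝕜 _ _ (u : V) (A v) = 0

/-- The kernel `ker(Id - T) = {x ∈ D(T) : Tx = x}`, as a submodule of `V`. -/
def kerIdSub (T : V →ₗ.[𝕜] V) : Submodule 𝕜 V :=
  (LinearMap.ker (T.domain.subtype - T.toFun)).map T.domain.subtype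

/-- The kernel `ker(Id + T) = {x ∈ D(T) : Tx = -x}`, as a submodule of `V`. -/
def kerIdAdd (T : V →ₗ.[𝕜] V) : Submodule 𝕜 V :=
  (LinearMap.ker (T.domain.subtype + T.toFun)).map T.domain.subtype

omit [CompleteSpace V] in
theorem mem_kerIdSub_iff {T : V →ₗ.[𝕜] V} {x : V} : x ∈ kerIdSub T ↔ (x, x) ∈ T.graph := by
  simp only [kerIdSub, Submodule.mem_map, LinearMap.mem_ker, LinearMap.sub_apply, sub_eq_zero,
    LinearPMap.mem_graph_iff, Submodule.subtype_apply, LinearPMap.toFun_eq_coe]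
  constructor
  · rintro ⟨y, hy, rfl⟩
    exact ⟨y, rfl, hy.symm⟩
  · rintro ⟨y, rfl, hy⟩
    exact ⟨y, hy.symm, rfl⟩

omit [CompleteSpace V] in
theorem mem_kerIdAdd_iff {T : V →ₗ.[𝕜] V} {x : V} : x ∈ kerIdAdd T ↔ (x, -x) ∈ T.graph := by
  simp only [kerIdAdd, Submodule.mem_map, LinearMap.mem_ker, LinearMap.add_apply,
    LinearPMap.mem_graph_iff, Submodule.subtype_apply, LinearPMap.toFun_eq_coe]
  constructor
  · rintro ⟨y, hy, rfl⟩
    exact ⟨y, rfl, (neg_eq_of_add_eq_zero_right hy).symm⟩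
  · rintro ⟨y, rfl, hy⟩
    exact ⟨y, by rw [hy, add_neg_cancel], rfl⟩

theorem mem_graph_adjoint_neg_iff {A₀ : V →ₗ.[𝕜] V} (hdense : Dense (A₀.domain : Set V))
    {x y : V} : (x, y) ∈ (-A₀).adjoint.graph ↔
      ∀ p ∈ A₀.graph, inner 𝕜 p.1 y + inner 𝕜 p.2 x = 0 := by
  rw [LinearPMap.adjoint_graph_eq_graph_adjoint (T := -A₀) hdense, Submodule.mem_adjoint_iff]
  constructor
  · rintro h ⟨u, v⟩ hp
    have := h u (-v) (by
      obtain ⟨z, rfl, rfl⟩ := A₀.mem_graph_iff.1 hp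
      exact (-A₀).mem_graph z)
    rw [inner_neg_left] at this
    linear_combination -this
  · intro h u v hp
    obtain ⟨z, rfl, rfl⟩ := (-A₀).mem_graph_iff.1 hp
    have := h _ (A₀.mem_graph z)
    rw [LinearPMap.neg_apply, inner_neg_left]
    linear_combination -this

theorem SkewSymmetric.le_adjoint_neg {A₀ : V →ₗ.[𝕜] V} (hskew : SkewSymmetric A₀)
    (hdense : Dense (A₀.domain : Set V)) : A₀ ≤ (-A₀).adjoint := by
  refine LinearPMap.IsFormalAdjoint.le_adjoint (T := -A₀) hdense fun u v => ?_
  rw [LinearPMap.neg_apply, inner_neg_left]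
  linear_combination -hskew u v

theorem SkewSymmetric.isClosable {A₀ : V →ₗ.[𝕜] V} (hskew : SkewSymmetric A₀)
    (hdense : Dense (A₀.domain : Set V)) : A₀.IsClosable :=
  (LinearPMap.adjoint_isClosed (T := -A₀) hdense).isClosable.leIsClosable
    (hskew.le_adjoint_neg hdense)

theorem SkewSymmetric.closure_le_adjoint_neg {A₀ : V →ₗ.[𝕜] V} (hskew : SkewSymmetric A₀)
    (hdense : Dense (A₀.domain : Set V)) : A₀.closure ≤ (-A₀).adjoint := by
  have hclosed : (-A₀).adjoint.IsClosed := LinearPMap.adjoint_isClosed (T := -A₀) hdense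
  rw [← LinearPMap.le_graph_iff, ← (hskew.isClosable hdense).graph_closure_eq_closure_graph]
  exact Submodule.topologicalClosure_minimal _
    (LinearPMap.le_graph_of_le (hskew.le_adjoint_neg hdense)) hclosed

theorem inner_add_inner_eq_zero_of_mem_graph {A₀ : V →ₗ.[𝕜] V} (hclos : A₀.IsClosable)
    (hdense : Dense (A₀.domain : Set V)) {p q : V × V} (hp : p ∈ A₀.closure.graph)
    (hq : q ∈ (-A₀).adjoint.graph) : inner 𝕜 p.1 q.2 + inner 𝕜 p.2 q.1 = 0 := by
  rw [← hclos.graph_closure_eq_closure_graph] at hp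
  refine closure_minimal (t := {p : V × V | inner 𝕜 p.1 q.2 + inner 𝕜 p.2 q.1 = 0})
    (fun p hp => (mem_graph_adjoint_neg_iff hdense).1 hq p hp)
    (isClosed_eq (by fun_prop) continuous_const) hp

/-- The deficiency subspaces intersect the domain of the closure trivially. -/
theorem eq_zero_of_add_add_eq_zero {A₀ : V →ₗ.[𝕜] V} (hdense : Dense (A₀.domain : Set V))
    (hskew : SkewSymmetric A₀) {x a b : V} (hx : x ∈ A₀.closure.domain)
    (ha : a ∈ kerIdSub (-A₀).adjoint) (hb : b ∈ kerIdAdd (-A₀).adjoint) (h : x + a + b = 0) :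
    x = 0 ∧ a = 0 ∧ b = 0 := by
  rw [mem_kerIdSub_iff] at ha
  rw [mem_kerIdAdd_iff] at hb
  obtain ⟨y, hxy⟩ := LinearPMap.mem_domain_iff.1 hx
  have hy : y + a - b = 0 := by
    have hsum := add_mem (add_mem
      (LinearPMap.le_graph_of_le (hskew.closure_le_adjoint_neg hdense) hxy) ha) hb
    have := LinearPMap.graph_fst_eq_zero_snd _ hsum h
    simpa [sub_eq_add_neg] using this
  have hinner := inner_add_inner_eq_zero_of_mem_graph (hskew.isClosable hdense) hdense hxy
    (sub_mem hb ha)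
  have h1 : -b - a = x := by linear_combination (norm := module) -h
  have h2 : b - a = y := by linear_combination (norm := module) -hy
  simp only [Prod.fst_sub, Prod.snd_sub, h1, h2, inner_self_eq_norm_sq_to_K] at hinner
  have hnorm : ‖x‖ ^ 2 + ‖y‖ ^ 2 = 0 := by exact_mod_cast hinner
  have hx0 : x = 0 := norm_eq_zero.1 (by nlinarith [sq_nonneg ‖x‖, sq_nonneg ‖y‖])
  have hy0 : y = 0 := norm_eq_zero.1 (by nlinarith [sq_nonneg ‖x‖, sq_nonneg ‖y‖])
  subst hx0 hy0
  have hab : b = a := sub_eq_zero.1 h2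
  subst hab
  have hb0 : (2 : 𝕜) • b = 0 := by rw [two_smul]; simpa using h
  have : b = 0 := (smul_eq_zero.1 hb0).resolve_left two_ne_zero
  exact ⟨rfl, this, this⟩

/-- Orthogonal projection onto the graph of the closure, in the Hilbert space `V × V`. -/
theorem exists_mem_graph_closure_inner_eq_zero {A₀ : V →ₗ.[𝕜] V} (hclos : A₀.IsClosable)
    (w : V × V) : ∃ p ∈ A₀.closure.graph, ∀ u ∈ A₀.graph,
      inner 𝕜 u.1 (w - p).1 + inner 𝕜 u.2 (w - p).2 = 0 := by
  let G : Submodule 𝕜 (WithLp 2 (V × V)) :=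
    A₀.closure.graph.comap (WithLp.linearEquiv 2 𝕜 (V × V)).toLinearMap
  have hG : IsClosed (G : Set (WithLp 2 (V × V))) :=
    hclos.closure_isClosed.preimage (WithLp.prod_continuous_ofLp 2 V V)
  have : CompleteSpace G := hG.completeSpace_coe
  obtain ⟨p, hp, q, hq, hpq⟩ := G.exists_add_mem_mem_orthogonal (WithLp.toLp 2 w)
  have hw : w - WithLp.ofLp p = WithLp.ofLp q := by
    rw [sub_eq_iff_eq_add', ← WithLp.ofLp_add, ← hpq]
  refine ⟨WithLp.ofLp p, hp, fun u hu => ?_⟩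
  rw [hw]
  exact hq (WithLp.toLp 2 u) (LinearPMap.le_graph_of_le A₀.le_closure hu)

theorem exists_domain_decomposition {A₀ : V →ₗ.[𝕜] V} (hdense : Dense (A₀.domain : Set V))
    (hskew : SkewSymmetric A₀) {w : V} (hw : w ∈ (-A₀).adjoint.domain) :
    ∃ x ∈ A₀.closure.domain, ∃ a ∈ kerIdSub (-A₀).adjoint, ∃ b ∈ kerIdAdd (-A₀).adjoint,
      w = x + a + b := by
  obtain ⟨z, hwz⟩ := LinearPMap.mem_domain_iff.1 hw
  obtain ⟨⟨x, y⟩, hxy, horth⟩ :=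
    exists_mem_graph_closure_inner_eq_zero (hskew.isClosable hdense) (w, z)
  have hpq : (w - x, z - y) ∈ (-A₀).adjoint.graph :=
    sub_mem hwz (LinearPMap.le_graph_of_le (hskew.closure_le_adjoint_neg hdense) hxy)
  have hqp : (z - y, w - x) ∈ (-A₀).adjoint.graph :=
    (mem_graph_adjoint_neg_iff hdense).2 horth
  refine ⟨x, LinearPMap.mem_domain_of_mem_graph hxy,
    (2⁻¹ : 𝕜) • ((w - x) + (z - y)), mem_kerIdSub_iff.2 ?_,
    (2⁻¹ : 𝕜) • ((w - x) - (z - y)), mem_kerIdAdd_iff.2 ?_, by module⟩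
  · simpa only [Prod.smul_mk, Prod.mk_add_mk, add_comm (z - y)] using
      Submodule.smul_mem _ (2⁻¹ : 𝕜) (add_mem hpq hqp)
  · simpa only [Prod.smul_mk, Prod.mk_sub_mk, ← smul_neg, neg_sub] using
      Submodule.smul_mem _ (2⁻¹ : 𝕜) (sub_mem hpq hqp)

/-- Let `A₀` be a densely defined skew-symmetric operator on a Hilbert space `V`, with closure
`Ā₀` and `A = (-A₀)*`. Then `D(A) = D(Ā₀) ⊕ ker(Id - A) ⊕ ker(Id + A)` as an algebraic
direct sum: every `w ∈ D(A)` has a unique decomposition `w = w₀ + w₊ + w₋` with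
`w₀ ∈ D(Ā₀)`, `Aw₊ = w₊` and `Aw₋ = -w₋`. -/
theorem domain_decomposition (A₀ : V →ₗ.[𝕜] V)
    (hdense : Dense (A₀.domain : Set V)) (hskew : SkewSymmetric A₀) :
    ∀ w : ((-A₀).adjoint).domain, ∃! t : V × V × V,
      t.1 ∈ A₀.closure.domain ∧ t.2.1 ∈ kerIdSub (-A₀).adjoint ∧
        t.2.2 ∈ kerIdAdd (-A₀).adjoint ∧ (w : V) = t.1 + t.2.1 + t.2.2 := by
  rintro ⟨w, hw⟩
  obtain ⟨x, hx, a, ha, b, hb, h⟩ := exists_domain_decomposition hdense hskew hw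
  refine ⟨(x, a, b), ⟨hx, ha, hb, h⟩, ?_⟩
  rintro ⟨x', a', b'⟩ ⟨hx', ha', hb', h'⟩
  dsimp only at hx' ha' hb' h'
  obtain ⟨h₁, h₂, h₃⟩ := eq_zero_of_add_add_eq_zero hdense hskew (sub_mem hx' hx)
    (sub_mem ha' ha) (sub_mem hb' hb) (by linear_combination (norm := module) h - h')
  rw [sub_eq_zero.1 h₁, sub_eq_zero.1 h₂, sub_eq_zero.1 h₃]
end

section
/- Let S be a densely defined symmetric operator on a complex Hilbert space V and let (H₋, H₊, Γ₋, Γ₊) be a boundary quadruple for S. The following assertions are equivalent: (i) S has a selfadjoint extension; (ii) there exists a unitary operator from H₊ onto H₋; (iii) there exists a unitary operator from ker(i·Id − S*) onto ker(i·Id + S*). -/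
variable {V : Type*} [NormedAddCommGroup V] [InnerProductSpace ℂ V] [CompleteSpace V]

/-- An operator `S` on a complex Hilbert space is *symmetric* if `⟪Su, v⟫ = ⟪u, Sv⟫` for all
`u, v ∈ D(S)`. -/
def SymmetricOp (S : V →ₗ.[ℂ] V) : Prop :=
  ∀ u v : S.domain, @inner ℂ _ _ (S u) (v : V) = @inner ℂ _ _ (u : V) (S v)

/-- A *boundary quadruple* `(H₋, H₊, Γ₋, Γ₊)` for a densely defined symmetric operator `S`
consists of complex pre-Hilbert spaces `H₋, H₊` and surjective linear maps
`Γ₋ : D(S*) → H₋`, `Γ₊ : D(S*) → H₊` such that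
`⟪S*u, v⟫ - ⟪u, S*v⟫ = i(⟪Γ₋u, Γ₋v⟫ - ⟪Γ₊u, Γ₊v⟫)` for all `u, v ∈ D(S*)` and
`ker Γ₊ + ker Γ₋ = D(S*)`. -/
def IsBoundaryQuadrupleSymm (S : V →ₗ.[ℂ] V) {Hm Hp : Type*}
    [NormedAddCommGroup Hm] [InnerProductSpace ℂ Hm]
    [NormedAddCommGroup Hp] [InnerProductSpace ℂ Hp]
    (Γm : S.adjoint.domain →ₗ[ℂ] Hm) (Γp : S.adjoint.domain →ₗ[ℂ] Hp) : Prop :=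
  Function.Surjective Γm ∧ Function.Surjective Γp ∧
    (∀ u v : S.adjoint.domain,
      @inner ℂ _ _ (S.adjoint u) (v : V) - @inner ℂ _ _ (u : V) (S.adjoint v) =
        Complex.I * (@inner ℂ _ _ (Γm u) (Γm v) - @inner ℂ _ _ (Γp u) (Γp v))) ∧
    LinearMap.ker Γp ⊔ LinearMap.ker Γm = ⊤

/-- The deficiency space `ker(i·Id - S*) = {x ∈ D(S*) : S*x = ix}`, as a submodule of `V`. -/
noncomputable def kerISub (S : V →ₗ.[ℂ] V) : Submodule ℂ V :=
  (LinearMap.ker (Complex.I • S.adjoint.domain.subtype - S.adjoint.toFun)).map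
    S.adjoint.domain.subtype

/-- The deficiency space `ker(i·Id + S*) = {x ∈ D(S*) : S*x = -ix}`, as a submodule of `V`. -/
noncomputable def kerIAdd (S : V →ₗ.[ℂ] V) : Submodule ℂ V :=
  (LinearMap.ker (Complex.I • S.adjoint.domain.subtype + S.adjoint.toFun)).map
    S.adjoint.domain.subtype

open scoped InnerProductSpace

/-- The boundary form `⟪S*u, v⟫ - ⟪u, S*v⟫` of the adjoint of `S`. -/
noncomputable def boundaryForm (S : V →ₗ.[ℂ] V) (u v : S.adjoint.domain) : ℂ :=
  ⟪S.adjoint u, (v : V)⟫_ℂ - ⟪(u : V), S.adjoint v⟫_ℂ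

lemma inner_adjoint_apply {S : V →ₗ.[ℂ] V} (hdense : Dense (S.domain : Set V))
    (y : S.adjoint.domain) (x : S.domain) : ⟪S.adjoint y, (x : V)⟫_ℂ = ⟪(y : V), S x⟫_ℂ :=
  S.adjoint_isFormalAdjoint hdense y x

lemma exists_adjoint_apply_eq {S : V →ₗ.[ℂ] V} (hdense : Dense (S.domain : Set V)) {y w : V}
    (h : ∀ x : S.domain, ⟪w, (x : V)⟫_ℂ = ⟪y, S x⟫_ℂ) :
    ∃ u : S.adjoint.domain, (u : V) = y ∧ S.adjoint u = w :=
  ⟨⟨y, S.mem_adjoint_domain_of_exists y ⟨w, h⟩⟩, rfl, S.adjoint_apply_eq hdense _ h⟩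

lemma SymmetricOp.exists_adjoint_apply_eq {S : V →ₗ.[ℂ] V} (hsym : SymmetricOp S)
    (hdense : Dense (S.domain : Set V)) (x : S.domain) :
    ∃ u : S.adjoint.domain, (u : V) = x ∧ S.adjoint u = S x :=
  _root_.exists_adjoint_apply_eq hdense fun z => hsym x z

lemma boundaryForm_eq_zero_of_mem_domain {S : V →ₗ.[ℂ] V} (hdense : Dense (S.domain : Set V))
    (u v : S.adjoint.domain) (x : S.domain) (hx : (v : V) = x) (hSx : S.adjoint v = S x) :
    boundaryForm S u v = 0 := by
  rw [boundaryForm, hx, hSx, inner_adjoint_apply hdense, sub_self]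

/-- The graph of `S*` as a subspace of the Hilbert space `V ⊕ V`. -/
noncomputable def adjointGraph (S : V →ₗ.[ℂ] V) : Submodule ℂ (WithLp 2 (V × V)) :=
  (LinearMap.range ((WithLp.linearEquiv 2 ℂ (V × V)).symm.toLinearMap ∘ₗ
    ((-S.toFun).prod S.domain.subtype)))ᗮ

instance (S : V →ₗ.[ℂ] V) : CompleteSpace (adjointGraph S) :=
  (Submodule.isClosed_orthogonal _).completeSpace_coe

lemma mem_adjointGraph_iff {S : V →ₗ.[ℂ] V} (e : WithLp 2 (V × V)) :
    e ∈ adjointGraph S ↔ ∀ x : S.domain, ⟪e.snd, (x : V)⟫_ℂ = ⟪e.fst, S x⟫_ℂ := by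
  simp only [adjointGraph, Submodule.mem_orthogonal', LinearMap.mem_range, forall_exists_index,
    forall_apply_eq_imp_iff]
  refine forall_congr' fun x => ?_
  simp only [WithLp.prod_inner_apply]
  change ⟪e.fst, -S x⟫_ℂ + ⟪e.snd, (x : V)⟫_ℂ = 0 ↔ _
  rw [inner_neg_right, neg_add_eq_zero, eq_comm]

lemma mem_adjointGraph {S : V →ₗ.[ℂ] V} (hdense : Dense (S.domain : Set V))
    (u : S.adjoint.domain) : WithLp.toLp 2 ((u : V), S.adjoint u) ∈ adjointGraph S :=
  (mem_adjointGraph_iff _).2 fun x => inner_adjoint_apply hdense u x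

lemma exists_of_mem_adjointGraph {S : V →ₗ.[ℂ] V} (hdense : Dense (S.domain : Set V))
    {e : WithLp 2 (V × V)} (he : e ∈ adjointGraph S) :
    ∃ u : S.adjoint.domain, (u : V) = e.fst ∧ S.adjoint u = e.snd :=
  exists_adjoint_apply_eq hdense ((mem_adjointGraph_iff e).1 he)

/-- The first coordinate map from the graph of `S*` to the domain of `S*`. -/
noncomputable def adjointGraphFst {S : V →ₗ.[ℂ] V} (hdense : Dense (S.domain : Set V)) :
    adjointGraph S →ₗ[ℂ] S.adjoint.domain where
  toFun e := ⟨(e : WithLp 2 (V × V)).fst, by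
    obtain ⟨u, hu, -⟩ := exists_of_mem_adjointGraph hdense e.2
    exact hu ▸ u.2⟩
  map_add' _ _ := rfl
  map_smul' _ _ := rfl

lemma adjoint_adjointGraphFst {S : V →ₗ.[ℂ] V} (hdense : Dense (S.domain : Set V))
    (e : adjointGraph S) :
    S.adjoint (adjointGraphFst hdense e) = (e : WithLp 2 (V × V)).snd := by
  obtain ⟨u, hu, hSu⟩ := exists_of_mem_adjointGraph hdense e.2
  rw [← hSu]
  congr 1
  exact Subtype.ext hu.symm

/-- A linear map on `D(S*)` which recovers the inner product from the boundary form on a subspace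
mapped onto the target is continuous for the graph norm. -/
lemma continuous_boundaryMap {S : V →ₗ.[ℂ] V} (hdense : Dense (S.domain : Set V))
    {H : Type*} [NormedAddCommGroup H] [InnerProductSpace ℂ H]
    (Γ : S.adjoint.domain →ₗ[ℂ] H) (N : Submodule ℂ S.adjoint.domain)
    (hN : ∀ x, ∃ v ∈ N, Γ v = x) {c : ℂ} (hc : c ≠ 0)
    (hform : ∀ u, ∀ v ∈ N, boundaryForm S u v = c * ⟪Γ u, Γ v⟫_ℂ) :
    Continuous ((UniformSpace.Completion.toComplₗᵢ (𝕜 := ℂ) (E := H)).toLinearMap ∘ₗ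
      Γ ∘ₗ adjointGraphFst hdense) := by
  refine LinearMap.continuous_of_seq_closed_graph _ fun e e₀ h he hh => ?_
  have key : ∀ x : H, ⟪h, (x : UniformSpace.Completion H)⟫_ℂ =
      ⟪((Γ (adjointGraphFst hdense e₀) : H) : UniformSpace.Completion H),
        (x : UniformSpace.Completion H)⟫_ℂ := by
    intro x
    obtain ⟨v, hv, rfl⟩ := hN x
    have h1 : Filter.Tendsto (fun n => c * ⟪((Γ (adjointGraphFst hdense (e n)) : H) :
        UniformSpace.Completion H), ((Γ v : H) : UniformSpace.Completion H)⟫_ℂ) Filter.atTop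
        (nhds (c * ⟪h, ((Γ v : H) : UniformSpace.Completion H)⟫_ℂ)) :=
      (Filter.Tendsto.inner hh tendsto_const_nhds).const_mul c
    have hcont : Continuous fun e : adjointGraph S =>
        boundaryForm S (adjointGraphFst hdense e) v := by
      simp only [boundaryForm, adjoint_adjointGraphFst]
      change Continuous fun e : adjointGraph S =>
        ⟪(e : WithLp 2 (V × V)).snd, (v : V)⟫_ℂ -
          ⟪(e : WithLp 2 (V × V)).fst, S.adjoint v⟫_ℂ
      have hs : Continuous fun e : adjointGraph S => (e : WithLp 2 (V × V)).snd :=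
        (continuous_snd.comp (WithLp.prod_continuous_ofLp 2 V V)).comp continuous_subtype_val
      have hf : Continuous fun e : adjointGraph S => (e : WithLp 2 (V × V)).fst :=
        (continuous_fst.comp (WithLp.prod_continuous_ofLp 2 V V)).comp continuous_subtype_val
      fun_prop
    have h2 := (hcont.tendsto e₀).comp he
    simp only [Function.comp_def, hform _ v hv] at h2
    simp only [UniformSpace.Completion.inner_coe] at h1
    have := mul_left_cancel₀ hc (tendsto_nhds_unique h1 h2)
    rw [this, UniformSpace.Completion.inner_coe]
  refine ext_inner_right ℂ fun y => ?_
  induction y using UniformSpace.Completion.induction_on with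
  | hp => exact isClosed_eq (by fun_prop) (by fun_prop)
  | ih x => exact key x

/-- The target of a boundary map is automatically complete. -/
lemma completeSpace_of_boundaryMap {S : V →ₗ.[ℂ] V} (hdense : Dense (S.domain : Set V))
    (hsym : SymmetricOp S) {H : Type*} [NormedAddCommGroup H] [InnerProductSpace ℂ H]
    (Γ : S.adjoint.domain →ₗ[ℂ] H) (N : Submodule ℂ S.adjoint.domain)
    (hN : ∀ x, ∃ v ∈ N, Γ v = x) {c : ℂ} (hc : c ≠ 0)
    (hform : ∀ u, ∀ v ∈ N, boundaryForm S u v = c * ⟪Γ u, Γ v⟫_ℂ) : CompleteSpace H := by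
  have hΓ : ∀ (u : S.adjoint.domain) (x : S.domain), (u : V) = x → S.adjoint u = S x →
      Γ u = 0 := by
    intro u x hu hSu
    obtain ⟨v, hv, hvu⟩ := hN (Γ u)
    have h := hform u v hv
    have h0 : boundaryForm S u v = 0 := by
      rw [boundaryForm, hu, hSu, sub_eq_zero, ← inner_conj_symm,
        ← inner_adjoint_apply hdense, inner_conj_symm]
    rw [h0, hvu] at h
    simpa [hc] using h.symm
  rw [completeSpace_iff_isComplete_range
    (UniformSpace.Completion.isUniformInducing_coe H)]
  suffices h : Set.range ((↑) : H → UniformSpace.Completion H) = Set.univ by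
    rw [h]; exact isComplete_univ
  rw [Set.range_eq_univ]
  intro h
  let F : adjointGraph S →L[ℂ] UniformSpace.Completion H :=
    ⟨_, continuous_boundaryMap hdense Γ N hN hc hform⟩
  let w : adjointGraph S := ContinuousLinearMap.adjoint F h
  have hw : ∀ e, ⟪w, e⟫_ℂ = ⟪h, F e⟫_ℂ := fun e => F.adjoint_inner_left e h
  have hw' : ∀ v : S.adjoint.domain, ⟪(w : WithLp 2 (V × V)).fst, (v : V)⟫_ℂ +
      ⟪(w : WithLp 2 (V × V)).snd, S.adjoint v⟫_ℂ =
      ⟪h, ((Γ v : H) : UniformSpace.Completion H)⟫_ℂ := by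
    intro v
    have := hw ⟨_, mem_adjointGraph hdense v⟩
    rw [Submodule.coe_inner, WithLp.prod_inner_apply] at this
    exact this
  obtain ⟨z, hz, hSz⟩ := exists_adjoint_apply_eq (S := S) hdense
    (y := (w : WithLp 2 (V × V)).snd) (w := -(w : WithLp 2 (V × V)).fst) (by
      intro x
      obtain ⟨u, hu, hSu⟩ := hsym.exists_adjoint_apply_eq hdense x
      have := hw' u
      rw [hΓ u x hu hSu, UniformSpace.Completion.coe_zero, inner_zero_right, hu, hSu] at this
      rw [inner_neg_left, neg_eq_iff_add_eq_zero, this])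
  refine ⟨-(starRingEnd ℂ c) • Γ z, ?_⟩
  refine ext_inner_right ℂ fun y => ?_
  induction y using UniformSpace.Completion.induction_on with
  | hp => exact isClosed_eq (by fun_prop) (by fun_prop)
  | ih x =>
    obtain ⟨v, hv, rfl⟩ := hN x
    have h1 := hform z v hv
    rw [boundaryForm, hz, hSz, inner_neg_left] at h1
    rw [UniformSpace.Completion.inner_coe, ← hw', inner_smul_left, map_neg, Complex.conj_conj]
    linear_combination h1

lemma norm_eq_of_inner_self_eq {X Y : Type*} [NormedAddCommGroup X] [InnerProductSpace ℂ X]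
    [NormedAddCommGroup Y] [InnerProductSpace ℂ Y] {x : X} {y : Y}
    (h : ⟪x, x⟫_ℂ = ⟪y, y⟫_ℂ) : ‖x‖ = ‖y‖ := by
  rw [inner_self_eq_norm_sq_to_K, inner_self_eq_norm_sq_to_K] at h
  exact (sq_eq_sq₀ (norm_nonneg _) (norm_nonneg _)).1 (by exact_mod_cast h)

/-- A subspace of `X × Y` which is its own orthogonal complement for the indefinite form
`⟪x, x'⟫ - ⟪y, y'⟫` projects onto `X`. -/
lemma exists_fst_eq_of_selfOrthogonal {X Y : Type*}
    [NormedAddCommGroup X] [InnerProductSpace ℂ X] [CompleteSpace X]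
    [NormedAddCommGroup Y] [InnerProductSpace ℂ Y] [CompleteSpace Y]
    (M : Submodule ℂ (X × Y))
    (hM : ∀ p, p ∈ M ↔ ∀ q ∈ M, ⟪q.1, p.1⟫_ℂ = ⟪q.2, p.2⟫_ℂ) (x : X) :
    ∃ p ∈ M, p.1 = x := by
  have hclosed : IsClosed (M : Set (X × Y)) := by
    have : (M : Set (X × Y)) = ⋂ q ∈ M, {p | ⟪q.1, p.1⟫_ℂ = ⟪q.2, p.2⟫_ℂ} := by
      ext p
      simpa using hM p
    rw [this]
    exact isClosed_biInter fun q _ => isClosed_eq (by fun_prop) (by fun_prop)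
  have : CompleteSpace M := hclosed.completeSpace_coe
  have hnorm : ∀ p ∈ M, ‖p.1‖ = ‖p.2‖ := fun p hp => norm_eq_of_inner_self_eq ((hM p).1 hp p hp)
  let π : M →ₗᵢ[ℂ] X := ⟨LinearMap.fst ℂ X Y ∘ₗ M.subtype, fun p => by
    change ‖(p : X × Y).1‖ = ‖(p : X × Y)‖
    rw [Prod.norm_def, ← hnorm p p.2, max_self]⟩
  have hR : IsClosed (Set.range π) := π.isometry.isClosedEmbedding.isClosed_range
  let R := LinearMap.range π.toLinearMap
  have : CompleteSpace R := hR.completeSpace_coe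
  have hbot : Rᗮ = ⊥ := by
    rw [eq_bot_iff]
    intro y hy
    have hmem : (y, (0 : Y)) ∈ M := (hM _).2 fun q hq => by
      rw [inner_zero_right]
      exact hy _ ⟨⟨q, hq⟩, rfl⟩
    have : ⟪y, y⟫_ℂ = 0 := hy y ⟨⟨_, hmem⟩, rfl⟩
    simpa using this
  have htop : x ∈ R := by
    rw [Submodule.orthogonal_eq_bot_iff.1 hbot]; trivial
  obtain ⟨p, hp⟩ := htop
  exact ⟨p, p.2, hp⟩

lemma nonempty_linearIsometryEquiv_of_selfOrthogonal {X Y : Type*}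
    [NormedAddCommGroup X] [InnerProductSpace ℂ X] [CompleteSpace X]
    [NormedAddCommGroup Y] [InnerProductSpace ℂ Y] [CompleteSpace Y]
    (M : Submodule ℂ (X × Y))
    (hM : ∀ p, p ∈ M ↔ ∀ q ∈ M, ⟪q.1, p.1⟫_ℂ = ⟪q.2, p.2⟫_ℂ) : Nonempty (X ≃ₗᵢ[ℂ] Y) := by
  have hnorm : ∀ p ∈ M, ‖p.1‖ = ‖p.2‖ := fun p hp => norm_eq_of_inner_self_eq ((hM p).1 hp p hp)
  let π₁ : M →ₗᵢ[ℂ] X := ⟨LinearMap.fst ℂ X Y ∘ₗ M.subtype, fun p => by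
    change ‖(p : X × Y).1‖ = ‖(p : X × Y)‖
    rw [Prod.norm_def, ← hnorm p p.2, max_self]⟩
  let π₂ : M →ₗᵢ[ℂ] Y := ⟨LinearMap.snd ℂ X Y ∘ₗ M.subtype, fun p => by
    change ‖(p : X × Y).2‖ = ‖(p : X × Y)‖
    rw [Prod.norm_def, hnorm p p.2, max_self]⟩
  have h₁ : Function.Surjective π₁ := fun x => by
    obtain ⟨p, hp, h⟩ := exists_fst_eq_of_selfOrthogonal M hM x
    exact ⟨⟨p, hp⟩, h⟩
  let M' : Submodule ℂ (Y × X) := M.comap (LinearEquiv.prodComm ℂ Y X).toLinearMap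
  have hM' : ∀ p, p ∈ M' ↔ ∀ q ∈ M', ⟪q.1, p.1⟫_ℂ = ⟪q.2, p.2⟫_ℂ := by
    intro p
    refine (hM p.swap).trans ⟨fun h q hq => (h q.swap hq).symm, fun h q hq => ?_⟩
    exact (h q.swap hq).symm
  have h₂ : Function.Surjective π₂ := fun y => by
    obtain ⟨p, hp, h⟩ := exists_fst_eq_of_selfOrthogonal M' hM' y
    exact ⟨⟨p.swap, hp⟩, h⟩
  exact ⟨(LinearIsometryEquiv.ofSurjective π₁ h₁).symm.trans
    (LinearIsometryEquiv.ofSurjective π₂ h₂)⟩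

namespace IsBoundaryQuadrupleSymm

variable {S : V →ₗ.[ℂ] V} {Hm Hp : Type*}
  [NormedAddCommGroup Hm] [InnerProductSpace ℂ Hm]
  [NormedAddCommGroup Hp] [InnerProductSpace ℂ Hp]
  {Γm : S.adjoint.domain →ₗ[ℂ] Hm} {Γp : S.adjoint.domain →ₗ[ℂ] Hp}

lemma boundaryForm_eq (hq : IsBoundaryQuadrupleSymm S Γm Γp) (u v : S.adjoint.domain) :
    boundaryForm S u v = Complex.I * (⟪Γm u, Γm v⟫_ℂ - ⟪Γp u, Γp v⟫_ℂ) :=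
  hq.2.2.1 u v

lemma exists_apply_eq (hq : IsBoundaryQuadrupleSymm S Γm Γp) (x : Hm) (y : Hp) :
    ∃ u, Γm u = x ∧ Γp u = y := by
  obtain ⟨a, rfl⟩ := hq.1 x
  obtain ⟨b, rfl⟩ := hq.2.1 y
  have split : ∀ w : S.adjoint.domain, ∃ p m, Γp p = 0 ∧ Γm m = 0 ∧ p + m = w := fun w => by
    have : w ∈ LinearMap.ker Γp ⊔ LinearMap.ker Γm := by rw [hq.2.2.2]; trivial
    obtain ⟨p, hp, m, hm, h⟩ := Submodule.mem_sup.1 this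
    exact ⟨p, m, hp, hm, h⟩
  obtain ⟨p, m, hp, hm, rfl⟩ := split a
  obtain ⟨p', m', hp', hm', rfl⟩ := split b
  exact ⟨p + m', by simp [hm, hm'], by simp [hp, hp']⟩

lemma completeSpace_left (hq : IsBoundaryQuadrupleSymm S Γm Γp)
    (hdense : Dense (S.domain : Set V)) (hsym : SymmetricOp S) : CompleteSpace Hm := by
  refine completeSpace_of_boundaryMap hdense hsym Γm (LinearMap.ker Γp) (fun x => ?_)
    Complex.I_ne_zero fun u v hv => ?_
  · obtain ⟨u, h, h'⟩ := hq.exists_apply_eq x 0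
    exact ⟨u, h', h⟩
  · rw [hq.boundaryForm_eq, LinearMap.mem_ker.1 hv, inner_zero_right, sub_zero]

lemma completeSpace_right (hq : IsBoundaryQuadrupleSymm S Γm Γp)
    (hdense : Dense (S.domain : Set V)) (hsym : SymmetricOp S) : CompleteSpace Hp := by
  refine completeSpace_of_boundaryMap hdense hsym Γp (LinearMap.ker Γm) (fun x => ?_)
    (neg_ne_zero.2 Complex.I_ne_zero) fun u v hv => ?_
  · obtain ⟨u, h, h'⟩ := hq.exists_apply_eq 0 x
    exact ⟨u, h, h'⟩
  · rw [hq.boundaryForm_eq, LinearMap.mem_ker.1 hv, inner_zero_right]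
    ring

lemma nonempty_unitary_of_selfAdjoint_extension (hq : IsBoundaryQuadrupleSymm S Γm Γp)
    (hdense : Dense (S.domain : Set V)) (hsym : SymmetricOp S) {T : V →ₗ.[ℂ] V} (hST : S ≤ T)
    (hTd : Dense (T.domain : Set V)) (hT : T.adjoint = T) : Nonempty (Hp ≃ₗᵢ[ℂ] Hm) := by
  have := hq.completeSpace_left hdense hsym
  have := hq.completeSpace_right hdense hsym
  have hTsym : ∀ s t : T.domain, ⟪T s, (t : V)⟫_ℂ = ⟪(s : V), T t⟫_ℂ := by
    have := T.adjoint_isFormalAdjoint hTd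
    rwa [hT] at this
  have hTmem : ∀ y w : V, (∀ t : T.domain, ⟪w, (t : V)⟫_ℂ = ⟪y, T t⟫_ℂ) → y ∈ T.domain := by
    intro y w h
    have := T.mem_adjoint_domain_of_exists y ⟨w, h⟩
    rwa [hT] at this
  have hTS : ∀ t : T.domain, ∃ u : S.adjoint.domain, (u : V) = t ∧ S.adjoint u = T t := by
    refine fun t => exists_adjoint_apply_eq hdense fun x => ?_
    have hx := hTsym t ⟨x, hST.1 x.2⟩
    rwa [← hST.2 (x := x) (y := ⟨x, hST.1 x.2⟩) rfl] at hx
  have hL : ∀ v : S.adjoint.domain, (v : V) ∈ T.domain ↔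
      ∀ u : S.adjoint.domain, (u : V) ∈ T.domain → boundaryForm S u v = 0 := by
    have hval : ∀ u : S.adjoint.domain, ∀ h : (u : V) ∈ T.domain,
        S.adjoint u = T ⟨u, h⟩ := fun u h => by
      obtain ⟨u', h1, h2⟩ := hTS ⟨u, h⟩
      rw [← h2, Subtype.ext h1]
    intro v
    constructor
    · intro hv u hu
      rw [boundaryForm, hval u hu, hval v hv, sub_eq_zero]
      exact hTsym ⟨u, hu⟩ ⟨v, hv⟩
    · intro h
      refine hTmem v (S.adjoint v) fun t => ?_
      obtain ⟨u, h1, h2⟩ := hTS t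
      have := h u (h1 ▸ t.2)
      rw [boundaryForm, h1, h2, sub_eq_zero] at this
      rw [← inner_conj_symm, ← this, inner_conj_symm]
  refine nonempty_linearIsometryEquiv_of_selfOrthogonal
    ((T.domain.comap S.adjoint.domain.subtype).map (Γp.prod Γm)) fun p => ?_
  obtain ⟨v, hv1, hv2⟩ := hq.exists_apply_eq p.2 p.1
  have hp : p = Γp.prod Γm v := by ext <;> simp [hv1, hv2]
  subst hp
  have hbf : ∀ u w, boundaryForm S u w = 0 ↔ ⟪Γp u, Γp w⟫_ℂ = ⟪Γm u, Γm w⟫_ℂ := fun u w => by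
    rw [hq.boundaryForm_eq, mul_eq_zero, or_iff_right Complex.I_ne_zero, sub_eq_zero, eq_comm]
  constructor
  · rintro ⟨v', hv', he⟩ q ⟨u, hu, rfl⟩
    rw [← he]
    exact (hbf u v').1 ((hL v').1 hv' u hu)
  · intro h
    exact ⟨v, (hL v).2 fun u hu => (hbf u v).2 (h _ ⟨u, hu, rfl⟩), rfl⟩

lemma exists_selfAdjoint_extension_of_unitary (hq : IsBoundaryQuadrupleSymm S Γm Γp)
    (hdense : Dense (S.domain : Set V)) (hsym : SymmetricOp S) (U : Hp ≃ₗᵢ[ℂ] Hm) :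
    ∃ T : V →ₗ.[ℂ] V, S ≤ T ∧ Dense (T.domain : Set V) ∧ T.adjoint = T := by
  let L : Submodule ℂ S.adjoint.domain :=
    LinearMap.ker (U.toLinearEquiv.toLinearMap ∘ₗ Γp - Γm)
  have hL : ∀ u, u ∈ L ↔ U (Γp u) = Γm u := fun u => by
    rw [LinearMap.mem_ker, LinearMap.sub_apply, sub_eq_zero]; rfl
  have hmax : ∀ v, (∀ u ∈ L, boundaryForm S u v = 0) → v ∈ L := by
    intro v h
    rw [hL]
    refine ext_inner_left ℂ fun y => ?_
    obtain ⟨u, h1, h2⟩ := hq.exists_apply_eq y (U.symm y)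
    have := h u ((hL u).2 (by rw [h1, h2, U.apply_symm_apply]))
    rw [hq.boundaryForm_eq, mul_eq_zero, or_iff_right Complex.I_ne_zero, sub_eq_zero, h1, h2]
      at this
    rw [this, ← U.inner_map_map, U.apply_symm_apply]
  have hiso : ∀ u ∈ L, ∀ v ∈ L, boundaryForm S u v = 0 := by
    intro u hu v hv
    rw [hq.boundaryForm_eq, ← (hL u).1 hu, ← (hL v).1 hv, U.inner_map_map, sub_self, mul_zero]
  let T : V →ₗ.[ℂ] V := S.adjoint.domRestrict (L.map S.adjoint.domain.subtype)
  have hTdom : ∀ y, y ∈ T.domain ↔ ∃ u ∈ L, (u : V) = y := by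
    intro y
    constructor
    · rintro ⟨hy, -⟩
      exact hy
    · rintro ⟨u, hu, rfl⟩
      exact ⟨⟨u, hu, rfl⟩, u.2⟩
  have hTle : T ≤ S.adjoint := LinearPMap.domRestrict_le
  have hTval : ∀ (t : T.domain) (u : S.adjoint.domain), (u : V) = t → T t = S.adjoint u :=
    fun t u h => hTle.2 h.symm
  have hST : S ≤ T := by
    have hmem : ∀ x : S.domain, ∃ u ∈ L, (u : V) = x ∧ S.adjoint u = S x := fun x => by
      obtain ⟨u, hu, hSu⟩ := hsym.exists_adjoint_apply_eq hdense x
      exact ⟨u, hmax u fun v _ => boundaryForm_eq_zero_of_mem_domain hdense v u x hu hSu, hu, hSu⟩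
    refine ⟨fun x hx => ?_, fun x y hxy => ?_⟩
    · obtain ⟨u, hu, h, -⟩ := hmem ⟨x, hx⟩
      exact (hTdom x).2 ⟨u, hu, h⟩
    · obtain ⟨u, -, h, h'⟩ := hmem x
      rw [hTval y u (h.trans hxy), h']
  have hTd : Dense (T.domain : Set V) := hdense.mono hST.1
  refine ⟨T, hST, hTd, le_antisymm ?_ ?_⟩
  · have hadj : ∀ y : T.adjoint.domain, ∃ u ∈ L, (u : V) = y ∧ S.adjoint u = T.adjoint y := by
      intro y
      obtain ⟨v, hv, hSv⟩ := exists_adjoint_apply_eq (S := S) hdense (y := (y : V))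
        (w := T.adjoint y) fun x => by
          have := inner_adjoint_apply hTd y ⟨x, hST.1 x.2⟩
          rwa [← hST.2 (x := x) (y := ⟨x, hST.1 x.2⟩) rfl] at this
      refine ⟨v, hmax v fun u hu => ?_, hv, hSv⟩
      have ht : (u : V) ∈ T.domain := (hTdom u).2 ⟨u, hu, rfl⟩
      have := inner_adjoint_apply hTd y ⟨u, ht⟩
      rw [hTval ⟨u, ht⟩ u rfl] at this
      rw [boundaryForm, hv, hSv, sub_eq_zero, ← inner_conj_symm, ← this, inner_conj_symm]
    refine ⟨fun y hy => ?_, fun y t hyt => ?_⟩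
    · obtain ⟨u, hu, h, -⟩ := hadj ⟨y, hy⟩
      exact (hTdom y).2 ⟨u, hu, h⟩
    · obtain ⟨u, -, h, h'⟩ := hadj y
      rw [hTval t u (h.trans hyt), h']
  · refine LinearPMap.IsFormalAdjoint.le_adjoint hTd fun s t => ?_
    obtain ⟨u, hu, h⟩ := (hTdom _).1 s.2
    obtain ⟨v, hv, h'⟩ := (hTdom _).1 t.2
    rw [hTval s u h, hTval t v h', ← h, ← h', ← sub_eq_zero]
    exact hiso u hu v hv

theorem exists_selfAdjoint_extension_iff (hq : IsBoundaryQuadrupleSymm S Γm Γp)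
    (hdense : Dense (S.domain : Set V)) (hsym : SymmetricOp S) :
    (∃ T : V →ₗ.[ℂ] V, S ≤ T ∧ Dense (T.domain : Set V) ∧ T.adjoint = T) ↔
      Nonempty (Hp ≃ₗᵢ[ℂ] Hm) :=
  ⟨fun ⟨_, h, hd, ha⟩ => hq.nonempty_unitary_of_selfAdjoint_extension hdense hsym h hd ha,
    fun ⟨U⟩ => hq.exists_selfAdjoint_extension_of_unitary hdense hsym U⟩

end IsBoundaryQuadrupleSymm

/-- Modulo the radical of the boundary form, every element of `D(S*)` is represented by an element
of the kernel of `(S*)² + 1`. -/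
lemma exists_adjoint_adjoint_eq_neg {S : V →ₗ.[ℂ] V} (hdense : Dense (S.domain : Set V))
    (hsym : SymmetricOp S) (u : S.adjoint.domain) :
    ∃ w z : S.adjoint.domain, S.adjoint w = z ∧ S.adjoint z = -w ∧
      ∀ v, boundaryForm S (u - w) v = 0 := by
  let K : Submodule ℂ (WithLp 2 (V × V)) :=
    LinearMap.range ((WithLp.linearEquiv 2 ℂ (V × V)).symm.toLinearMap ∘ₗ
      (S.domain.subtype.prod S.toFun))
  have hK : ∀ e, e ∈ Kᗮ ↔ ∀ x : S.domain, ⟪e.fst, (x : V)⟫_ℂ + ⟪e.snd, S x⟫_ℂ = 0 := by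
    intro e
    simp only [K, Submodule.mem_orthogonal', LinearMap.mem_range, forall_exists_index,
      forall_apply_eq_imp_iff]
    refine forall_congr' fun x => ?_
    rw [WithLp.prod_inner_apply]
    rfl
  let e : WithLp 2 (V × V) := WithLp.toLp 2 ((u : V), S.adjoint u)
  have : CompleteSpace Kᗮ := (Submodule.isClosed_orthogonal K).completeSpace_coe
  have : (Kᗮ).HasOrthogonalProjection := .ofCompleteSpace _
  obtain ⟨q, hq, p, hp, hqp⟩ := (Kᗮ).exists_add_mem_mem_orthogonal e
  obtain ⟨r, hr, hSr⟩ := exists_adjoint_apply_eq (S := S) hdense (y := p.fst) (w := p.snd) (by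
    intro x
    have hx : WithLp.toLp 2 (-S x, (x : V)) ∈ Kᗮ := (hK _).2 fun y => by
      change ⟪-S x, (y : V)⟫_ℂ + ⟪(x : V), S y⟫_ℂ = 0
      rw [inner_neg_left, hsym x y, neg_add_cancel]
    have := (Submodule.mem_orthogonal' _ _).1 hp _ hx
    rw [WithLp.prod_inner_apply] at this
    change ⟪p.fst, -S x⟫_ℂ + ⟪p.snd, (x : V)⟫_ℂ = 0 at this
    rw [inner_neg_right] at this
    linear_combination this)
  obtain ⟨z, hz, hSz⟩ := exists_adjoint_apply_eq (S := S) hdense (y := q.snd) (w := -q.fst) (by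
    intro x
    have := (hK q).1 hq x
    rw [inner_neg_left]
    linear_combination -this)
  have h1 : (u : V) = q.fst + p.fst := congrArg WithLp.fst hqp
  have h2 : S.adjoint u = q.snd + p.snd := congrArg WithLp.snd hqp
  refine ⟨u - r, z, ?_, ?_, fun v => ?_⟩
  · rw [LinearPMap.map_sub, h2, hSr, hz, add_sub_cancel_right]
  · rw [hSz, Submodule.coe_sub, h1, hr, add_sub_cancel_right]
  · rw [sub_sub_cancel]
    have hv : WithLp.toLp 2 (-S.adjoint v, (v : V)) ∈ Kᗮ := (hK _).2 fun y => by
      change ⟪-S.adjoint v, (y : V)⟫_ℂ + ⟪(v : V), S y⟫_ℂ = 0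
      rw [inner_neg_left, inner_adjoint_apply hdense, neg_add_cancel]
    have := (Submodule.mem_orthogonal' _ _).1 hp _ hv
    rw [WithLp.prod_inner_apply] at this
    change ⟪p.fst, -S.adjoint v⟫_ℂ + ⟪p.snd, (v : V)⟫_ℂ = 0 at this
    rw [inner_neg_right] at this
    rw [boundaryForm, hr, hSr]
    linear_combination this

lemma mem_kerISub_iff {S : V →ₗ.[ℂ] V} {x : V} :
    x ∈ kerISub S ↔ ∃ u : S.adjoint.domain, (u : V) = x ∧ S.adjoint u = Complex.I • x := by
  constructor
  · rintro ⟨u, hu, rfl⟩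
    exact ⟨u, rfl, (sub_eq_zero.1 hu).symm⟩
  · rintro ⟨u, rfl, hu⟩
    exact ⟨u, sub_eq_zero.2 hu.symm, rfl⟩

lemma mem_kerIAdd_iff {S : V →ₗ.[ℂ] V} {x : V} :
    x ∈ kerIAdd S ↔ ∃ u : S.adjoint.domain, (u : V) = x ∧ S.adjoint u = -(Complex.I • x) := by
  constructor
  · rintro ⟨u, hu, rfl⟩
    exact ⟨u, rfl, (neg_eq_of_add_eq_zero_right hu).symm⟩
  · rintro ⟨u, rfl, hu⟩
    exact ⟨u, (add_eq_zero_iff_eq_neg'.2 hu), rfl⟩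

lemma isClosed_kerISub {S : V →ₗ.[ℂ] V} (hdense : Dense (S.domain : Set V)) :
    IsClosed (kerISub S : Set V) := by
  have : (kerISub S : Set V) =
      ⋂ x : S.domain, {y | ⟪Complex.I • y, (x : V)⟫_ℂ = ⟪y, S x⟫_ℂ} := by
    ext y
    rw [SetLike.mem_coe, mem_kerISub_iff, Set.mem_iInter]
    refine ⟨fun ⟨u, hu, hSu⟩ x => ?_, fun h => exists_adjoint_apply_eq hdense h⟩
    have := inner_adjoint_apply hdense u x
    rwa [hu, hSu] at this
  rw [this]
  exact isClosed_iInter fun x => isClosed_eq (by fun_prop) (by fun_prop)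

lemma isClosed_kerIAdd {S : V →ₗ.[ℂ] V} (hdense : Dense (S.domain : Set V)) :
    IsClosed (kerIAdd S : Set V) := by
  have : (kerIAdd S : Set V) =
      ⋂ x : S.domain, {y | ⟪-(Complex.I • y), (x : V)⟫_ℂ = ⟪y, S x⟫_ℂ} := by
    ext y
    rw [SetLike.mem_coe, mem_kerIAdd_iff, Set.mem_iInter]
    refine ⟨fun ⟨u, hu, hSu⟩ x => ?_, fun h => exists_adjoint_apply_eq hdense h⟩
    have := inner_adjoint_apply hdense u x
    rwa [hu, hSu] at this
  rw [this]
  exact isClosed_iInter fun x => isClosed_eq (by fun_prop) (by fun_prop)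

lemma boundaryForm_swap (S : V →ₗ.[ℂ] V) (u v : S.adjoint.domain) :
    boundaryForm S u v = -starRingEnd ℂ (boundaryForm S v u) := by
  simp [boundaryForm]

/-- The von Neumann decomposition of `D(S*)`, modulo the radical of the boundary form. -/
lemma exists_deficiency_decomposition {S : V →ₗ.[ℂ] V} (hdense : Dense (S.domain : Set V))
    (hsym : SymmetricOp S) (u : S.adjoint.domain) :
    ∃ p m r : S.adjoint.domain, S.adjoint p = Complex.I • (p : V) ∧
      S.adjoint m = -(Complex.I • (m : V)) ∧ (∀ v, boundaryForm S r v = 0) ∧ u = p + m + r := by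
  obtain ⟨w, z, hw, hz, hr⟩ := exists_adjoint_adjoint_eq_neg hdense hsym u
  refine ⟨(1 / 2 : ℂ) • (w - Complex.I • z), (1 / 2 : ℂ) • (w + Complex.I • z), u - w,
    ?_, ?_, hr, by module⟩
  · simp only [LinearPMap.map_smul, LinearPMap.map_sub, hw, hz, Submodule.coe_smul,
      Submodule.coe_sub]
    match_scalars
    · linear_combination (1 / 2 : ℂ) * Complex.I_mul_I
    · ring
  · simp only [LinearPMap.map_smul, LinearPMap.map_add, hw, hz, Submodule.coe_smul,
      Submodule.coe_add]
    match_scalars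
    · linear_combination (1 / 2 : ℂ) * Complex.I_mul_I
    · ring

/-- The deficiency spaces of a densely defined symmetric operator form a boundary quadruple. -/
lemma SymmetricOp.exists_deficiency_boundaryQuadruple {S : V →ₗ.[ℂ] V} (hsym : SymmetricOp S)
    (hdense : Dense (S.domain : Set V)) :
    ∃ (Γm : S.adjoint.domain →ₗ[ℂ] kerIAdd S) (Γp : S.adjoint.domain →ₗ[ℂ] kerISub S),
      IsBoundaryQuadrupleSymm S Γm Γp := by
  have : CompleteSpace (kerISub S) := (isClosed_kerISub hdense).completeSpace_coe
  have : CompleteSpace (kerIAdd S) := (isClosed_kerIAdd hdense).completeSpace_coe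
  let c : ℂ := ((√2 : ℝ) : ℂ)
  have hc : c * c = 2 := by
    rw [← Complex.ofReal_mul, Real.mul_self_sqrt zero_le_two, Complex.ofReal_ofNat]
  have hc' : starRingEnd ℂ c = c := Complex.conj_ofReal _
  have hc0 : c ≠ 0 := fun h => by simp [h] at hc
  let Γp : S.adjoint.domain →ₗ[ℂ] kerISub S := (c / 2) •
    ((kerISub S).orthogonalProjectionOnto.toLinearMap ∘ₗ
      (S.adjoint.domain.subtype - Complex.I • S.adjoint.toFun))
  let Γm : S.adjoint.domain →ₗ[ℂ] kerIAdd S := (c / 2) •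
    ((kerIAdd S).orthogonalProjectionOnto.toLinearMap ∘ₗ
      (S.adjoint.domain.subtype + Complex.I • S.adjoint.toFun))
  have hΓp : ∀ u, Γp u = (c / 2) • (kerISub S).orthogonalProjectionOnto
      ((u : V) - Complex.I • S.adjoint u) := fun _ => rfl
  have hΓm : ∀ u, Γm u = (c / 2) • (kerIAdd S).orthogonalProjectionOnto
      ((u : V) + Complex.I • S.adjoint u) := fun _ => rfl
  have hpr : ∀ r, (∀ v, boundaryForm S r v = 0) → Γp r = 0 := by
    intro r hr
    rw [hΓp, Submodule.orthogonalProjectionOnto_eq_zero_iff.2, smul_zero]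
    refine (Submodule.mem_orthogonal' _ _).2 fun x hx => ?_
    obtain ⟨v, rfl, hv⟩ := mem_kerISub_iff.1 hx
    have h := hr v
    rw [boundaryForm, hv, inner_smul_right] at h
    rw [inner_sub_left, inner_smul_left, Complex.conj_I]
    linear_combination Complex.I * h + ⟪(r : V), (v : V)⟫_ℂ * Complex.I_mul_I
  have hmr : ∀ r, (∀ v, boundaryForm S r v = 0) → Γm r = 0 := by
    intro r hr
    rw [hΓm, Submodule.orthogonalProjectionOnto_eq_zero_iff.2, smul_zero]
    refine (Submodule.mem_orthogonal' _ _).2 fun x hx => ?_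
    obtain ⟨v, rfl, hv⟩ := mem_kerIAdd_iff.1 hx
    have h := hr v
    rw [boundaryForm, hv, inner_neg_right, inner_smul_right] at h
    rw [inner_add_left, inner_smul_left, Complex.conj_I]
    linear_combination -Complex.I * h + ⟪(r : V), (v : V)⟫_ℂ * Complex.I_mul_I
  have hpp : ∀ p : S.adjoint.domain, S.adjoint p = Complex.I • (p : V) →
      ((Γp p : kerISub S) : V) = c • (p : V) ∧ Γm p = 0 := by
    intro p hp
    have h1 : (p : V) - Complex.I • S.adjoint p = (2 : ℂ) • (p : V) := by
      rw [hp, smul_smul, Complex.I_mul_I]; module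
    have h2 : (p : V) + Complex.I • S.adjoint p = 0 := by
      rw [hp, smul_smul, Complex.I_mul_I]; module
    refine ⟨?_, by rw [hΓm, h2, map_zero, smul_zero]⟩
    have hmem : (p : V) ∈ kerISub S := mem_kerISub_iff.2 ⟨p, rfl, hp⟩
    rw [hΓp, h1, map_smul, smul_smul, div_mul_cancel₀ _ two_ne_zero, Submodule.coe_smul,
      Submodule.coe_orthogonalProjectionOnto_apply, Submodule.starProjection_eq_self_iff.2 hmem]
  have hmm : ∀ m : S.adjoint.domain, S.adjoint m = -(Complex.I • (m : V)) →
      ((Γm m : kerIAdd S) : V) = c • (m : V) ∧ Γp m = 0 := by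
    intro m hm
    have h1 : (m : V) + Complex.I • S.adjoint m = (2 : ℂ) • (m : V) := by
      rw [hm, smul_neg, smul_smul, Complex.I_mul_I]; module
    have h2 : (m : V) - Complex.I • S.adjoint m = 0 := by
      rw [hm, smul_neg, smul_smul, Complex.I_mul_I]; module
    refine ⟨?_, by rw [hΓp, h2, map_zero, smul_zero]⟩
    have hmem : (m : V) ∈ kerIAdd S := mem_kerIAdd_iff.2 ⟨m, rfl, hm⟩
    rw [hΓm, h1, map_smul, smul_smul, div_mul_cancel₀ _ two_ne_zero, Submodule.coe_smul,
      Submodule.coe_orthogonalProjectionOnto_apply, Submodule.starProjection_eq_self_iff.2 hmem]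
  refine ⟨Γm, Γp, fun x => ?_, fun x => ?_, fun u v => ?_, ?_⟩
  · obtain ⟨m, hm, hSm⟩ := mem_kerIAdd_iff.1 x.2
    refine ⟨c⁻¹ • m, Subtype.ext ?_⟩
    rw [map_smul, Submodule.coe_smul, (hmm m (hm ▸ hSm)).1, inv_smul_smul₀ hc0, hm]
  · obtain ⟨p, hp, hSp⟩ := mem_kerISub_iff.1 x.2
    refine ⟨c⁻¹ • p, Subtype.ext ?_⟩
    rw [map_smul, Submodule.coe_smul, (hpp p (hp ▸ hSp)).1, inv_smul_smul₀ hc0, hp]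
  · change boundaryForm S u v = _
    obtain ⟨p, m, r, hp, hm, hr, rfl⟩ := exists_deficiency_decomposition hdense hsym u
    obtain ⟨p', m', r', hp', hm', hr', rfl⟩ := exists_deficiency_decomposition hdense hsym v
    have h1 : boundaryForm S (p + m + r) (p' + m' + r') = boundaryForm S (p + m) (p' + m') := by
      have h2 := hr (p' + m' + r')
      have h3 := boundaryForm_swap S (p + m) r'
      rw [hr', map_zero, neg_zero] at h3
      simp only [boundaryForm, LinearPMap.map_add, Submodule.coe_add, inner_add_left,
        inner_add_right] at h2 h3 ⊢
      linear_combination h2 + h3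
    simp only [map_add, hpr r hr, hmr r hr, hpr r' hr', hmr r' hr', (hpp p hp).2, (hpp p' hp').2,
      (hmm m hm).2, (hmm m' hm').2, add_zero, zero_add, Submodule.coe_inner, (hpp p hp).1,
      (hpp p' hp').1, (hmm m hm).1, (hmm m' hm').1, inner_smul_left, inner_smul_right, hc']
    rw [h1, boundaryForm]
    simp only [LinearPMap.map_add, hp, hm, hp', hm', Submodule.coe_add, inner_add_left,
      inner_add_right, inner_neg_left, inner_neg_right, inner_smul_left, inner_smul_right,
      Complex.conj_I]
    linear_combination Complex.I * (⟪(p : V), (p' : V)⟫_ℂ - ⟪(m : V), (m' : V)⟫_ℂ) * hc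
  · rw [eq_top_iff]
    intro u _
    obtain ⟨p, m, r, hp, hm, hr, rfl⟩ := exists_deficiency_decomposition hdense hsym u
    rw [add_assoc, add_comm]
    refine Submodule.add_mem_sup (LinearMap.mem_ker.2 ?_) (LinearMap.mem_ker.2 (hpp p hp).2)
    rw [map_add, (hmm m hm).2, hpr r hr, add_zero]

/-- Let `S` be a densely defined symmetric operator on a complex Hilbert space with boundary
quadruple `(H₋, H₊, Γ₋, Γ₊)`.  The following are equivalent: (i) `S` has a selfadjoint
extension; (ii) `H₊` and `H₋` are unitarily isomorphic; (iii) `ker(i·Id - S*)` and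
`ker(i·Id + S*)` are unitarily isomorphic. -/
theorem exists_selfAdjoint_extension_tfae {Hm Hp : Type*}
    [NormedAddCommGroup Hm] [InnerProductSpace ℂ Hm]
    [NormedAddCommGroup Hp] [InnerProductSpace ℂ Hp]
    (S : V →ₗ.[ℂ] V) (hdense : Dense (S.domain : Set V)) (hsym : SymmetricOp S)
    (Γm : S.adjoint.domain →ₗ[ℂ] Hm) (Γp : S.adjoint.domain →ₗ[ℂ] Hp)
    (hq : IsBoundaryQuadrupleSymm S Γm Γp) :
    ((∃ T : V →ₗ.[ℂ] V, S ≤ T ∧ Dense (T.domain : Set V) ∧ T.adjoint = T) ↔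
        Nonempty (Hp ≃ₗᵢ[ℂ] Hm)) ∧
      (Nonempty (Hp ≃ₗᵢ[ℂ] Hm) ↔ Nonempty (↥(kerISub S) ≃ₗᵢ[ℂ] ↥(kerIAdd S))) := by
  obtain ⟨Γm', Γp', hq'⟩ := hsym.exists_deficiency_boundaryQuadruple hdense
  have h := hq.exists_selfAdjoint_extension_iff hdense hsym
  exact ⟨h, h.symm.trans (hq'.exists_selfAdjoint_extension_iff hdense hsym)⟩
end
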